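/- arXiv:0901.0441 — 3 statements merged into one kernel-verified Lean document; each statement's English description precedes it below -/
import Mathlib

section
/- Let (M, 𝒜, μ) be a measure space and T : M → M a measurable map. For each ε > 0 let A_ε, D_ε ∈ 𝒜 with D_ε ⊆ A_ε, 0 < μ(D_ε) and 0 < μ(A_ε) < ∞, and assume μ(A_ε) → 0 as ε → 0. Suppose there exist β > 0 and c > 0 such that for every ε > 0, every integer q ≥ 1 and every measurable E ⊆ A_ε, both |μ(D_ε ∩ T^{-q}E) − (β/q)·μ(D_ε)·μ(E)| ≤ c·q^{-3/2} and |μ(A_ε ∩ T^{-q}E) − (β/q)·μ(A_ε)·μ(E)| ≤ c·q^{-3/2}. Suppose moreover there are reals M_ε → ∞ such that μ(A_ε)·log M_ε → 0, M_ε^{-1/2}/μ(D_ε) → 0, μ({W_{A_ε} ≤ M_ε} | D_ε) → 0 and μ({W_{A_ε} ≤ M_ε} | A_ε) → 0 as ε → 0. Then for every t > 0, μ( {W_{A_ε} > exp(t/μ(A_ε))} | D_ε ) → 1/(1 + β t) as ε → 0. -/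
open MeasureTheory Filter Set Topology

/-- The set `{W_A > N}` of points whose orbit avoids `A` at all times `1, …, N`. -/
def avoidUpTo {M : Type*} (T : M → M) (A : Set M) (N : ℕ) : Set M :=
  {x | ∀ n : ℕ, 1 ≤ n → n ≤ N → T^[n] x ∉ A}

lemma measurableSet_avoidUpTo {M : Type*} [MeasurableSpace M] {T : M → M} (hT : Measurable T)
    {A : Set M} (hA : MeasurableSet A) (N : ℕ) : MeasurableSet (avoidUpTo T A N) := by
  simp only [avoidUpTo, ofPred_forall]
  exact .iInter fun n => .iInter fun _ => .iInter fun _ => ((hT.iterate n) hA).compl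

lemma rpow_neg_three_halves_le (q : ℕ) (hq : 1 ≤ q) :
    (q : ℝ) ^ (-(3 : ℝ) / 2) ≤
      4 * ((q : ℝ) ^ (-(1 : ℝ) / 2) - ((q + 1 : ℕ) : ℝ) ^ (-(1 : ℝ) / 2)) := by
  have hq1 : (1 : ℝ) ≤ q := by exact_mod_cast hq
  have hq0 : (0 : ℝ) < q := by linarith
  have key : ∀ x : ℝ, 0 < x → x ^ (-(1 : ℝ) / 2) = (√x)⁻¹ := fun x hx => by
    rw [Real.sqrt_eq_rpow, ← Real.rpow_neg hx.le]; norm_num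
  have h3 : (q : ℝ) ^ (-(3 : ℝ) / 2) = (√(q : ℝ) ^ 3)⁻¹ := by
    rw [Real.sqrt_eq_rpow, ← Real.rpow_natCast, ← Real.rpow_mul hq0.le, ← Real.rpow_neg hq0.le]
    norm_num
  rw [h3, key _ hq0, key _ (by positivity)]
  push_cast
  have hs : 0 < √(q : ℝ) := Real.sqrt_pos.2 hq0
  have hr : 0 < √((q : ℝ) + 1) := Real.sqrt_pos.2 (by linarith)
  have hs2 := Real.sq_sqrt hq0.le
  have hr2 := Real.sq_sqrt (show (0 : ℝ) ≤ q + 1 by linarith)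
  generalize √(q : ℝ) = s at *
  generalize √((q : ℝ) + 1) = r at *
  have hr_le : r ≤ 3 / 2 * s := by nlinarith
  have hdiff : (r - s) * (r + s) = 1 := by nlinarith
  have hrs : r * (r + s) ≤ 4 * s ^ 2 := by nlinarith
  have heq : s⁻¹ - r⁻¹ = (s * (r * (r + s)))⁻¹ := by
    field_simp
    linarith
  rw [heq, ← div_eq_mul_inv, inv_eq_one_div, div_le_div_iff₀ (by positivity) (by positivity)]
  nlinarith

lemma sum_Ioc_rpow_neg_three_halves_le {m n : ℕ} (hmn : m ≤ n) :
    ∑ q ∈ Finset.Ioc m n, (q : ℝ) ^ (-(3 : ℝ) / 2) ≤ 4 * ((m + 1 : ℕ) : ℝ) ^ (-(1 : ℝ) / 2) := by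
  suffices h : ∑ q ∈ Finset.Ioc m n, (q : ℝ) ^ (-(3 : ℝ) / 2) ≤
      4 * (((m + 1 : ℕ) : ℝ) ^ (-(1 : ℝ) / 2) - ((n + 1 : ℕ) : ℝ) ^ (-(1 : ℝ) / 2)) by
    have : 0 ≤ ((n + 1 : ℕ) : ℝ) ^ (-(1 : ℝ) / 2) := by positivity
    linarith
  induction n, hmn using Nat.le_induction with
  | base => simp
  | succ n hmn ih =>
    rw [Finset.sum_Ioc_succ_top (by omega)]
    have := rpow_neg_three_halves_le (n + 1) (by omega)
    linarith

lemma sum_Ioc_inv_eq_harmonic_sub {m n : ℕ} (hmn : m ≤ n) :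
    ∑ q ∈ Finset.Ioc m n, (q : ℝ)⁻¹ = (harmonic n : ℝ) - harmonic m := by
  induction n, hmn using Nat.le_induction with
  | base => simp
  | succ n hmn ih =>
    rw [Finset.sum_Ioc_succ_top (by omega), ih, harmonic_succ]
    push_cast
    ring

lemma sum_Ioc_inv_two_mul_le (n : ℕ) : ∑ q ∈ Finset.Ioc n (2 * n), (q : ℝ)⁻¹ ≤ 1 := by
  rcases Nat.eq_zero_or_pos n with rfl | hn
  · simp
  have hn' : (0 : ℝ) < n := by exact_mod_cast hn
  calc ∑ q ∈ Finset.Ioc n (2 * n), (q : ℝ)⁻¹ ≤ ∑ q ∈ Finset.Ioc n (2 * n), (n : ℝ)⁻¹ := by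
        refine Finset.sum_le_sum fun q hq => ?_
        have : (n : ℝ) ≤ q := by exact_mod_cast (Finset.mem_Ioc.1 hq).1.le
        gcongr
    _ = 1 := by
        rw [Finset.sum_const, Nat.card_Ioc, show 2 * n - n = n by omega, nsmul_eq_mul]
        exact mul_inv_cancel₀ hn'.ne'

section LastVisit

variable {M : Type*} [MeasurableSpace M] {μ : Measure M} {T : M → M} {A D : Set M} {m N : ℕ}

/-- Splitting `D` along the last visit to `A` before time `2 * N`. -/
lemma measureReal_le_of_last_visit (hDA : D ⊆ A) (hfin : μ A ≠ ⊤) :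
    μ.real D ≤ μ.real (avoidUpTo T A N ∩ D) + μ.real ((avoidUpTo T A m)ᶜ ∩ D)
      + ∑ q ∈ Finset.Ioc m N, μ.real (D ∩ T^[q] ⁻¹' (avoidUpTo T A N ∩ A))
      + ∑ q ∈ Finset.Ioc N (2 * N), μ.real (D ∩ T^[q] ⁻¹' A) := by
  have hDfin : μ D ≠ ⊤ := measure_ne_top_of_subset hDA hfin
  have hsub : D ⊆ ((avoidUpTo T A N ∩ D ∪ (avoidUpTo T A m)ᶜ ∩ D)
      ∪ ⋃ q ∈ Finset.Ioc m N, D ∩ T^[q] ⁻¹' (avoidUpTo T A N ∩ A))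
      ∪ ⋃ q ∈ Finset.Ioc N (2 * N), D ∩ T^[q] ⁻¹' A := by
    intro x hx
    by_contra hcon
    simp only [mem_union, mem_iUnion, mem_inter_iff, hx, and_true, true_and, mem_compl_iff,
      Finset.mem_Ioc, mem_preimage, not_or, not_exists, not_not] at hcon
    obtain ⟨⟨⟨hN, hm⟩, hq⟩, hlate⟩ := hcon
    simp only [avoidUpTo, mem_ofPred_eq, not_forall, not_not] at hN
    obtain ⟨n, hn1, hnN, hnA⟩ := hN
    classical
    obtain ⟨hk1, hkA⟩ := Nat.findGreatest_spec (P := fun k => 1 ≤ k ∧ T^[k] x ∈ A) hnN ⟨hn1, hnA⟩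
    have hkN := Nat.findGreatest_le (P := fun k => 1 ≤ k ∧ T^[k] x ∈ A) N
    have hmax : ∀ j, Nat.findGreatest (fun k => 1 ≤ k ∧ T^[k] x ∈ A) N < j → j ≤ N →
        ¬ (1 ≤ j ∧ T^[j] x ∈ A) := fun j hj hjN => Nat.findGreatest_is_greatest hj hjN
    generalize Nat.findGreatest (fun k => 1 ≤ k ∧ T^[k] x ∈ A) N = k at *
    have hmk : m < k := not_le.1 fun h => hm k hk1 h hkA
    refine hq k ⟨hmk, hkN⟩ ⟨fun j hj1 hjN hjA => ?_, hkA⟩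
    rw [← Function.iterate_add_apply] at hjA
    rcases le_or_gt (j + k) N with h | h
    · exact hmax (j + k) (by omega) h ⟨by omega, hjA⟩
    · exact hlate (j + k) ⟨h, by omega⟩ hjA
  have hfin' : μ (((avoidUpTo T A N ∩ D ∪ (avoidUpTo T A m)ᶜ ∩ D)
      ∪ ⋃ q ∈ Finset.Ioc m N, D ∩ T^[q] ⁻¹' (avoidUpTo T A N ∩ A))
      ∪ ⋃ q ∈ Finset.Ioc N (2 * N), D ∩ T^[q] ⁻¹' A) ≠ ⊤ := by
    refine measure_ne_top_of_subset ?_ hDfin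
    simp only [union_subset_iff, iUnion_subset_iff, inter_subset_left, inter_subset_right,
      implies_true, and_self]
  refine (measureReal_mono hsub hfin').trans ((measureReal_union_le _ _).trans ?_)
  gcongr
  · refine (measureReal_union_le _ _).trans ?_
    gcongr
    · exact measureReal_union_le _ _
    · exact measureReal_biUnion_finset_le _ _
  · exact measureReal_biUnion_finset_le _ _

/-- The sets on which the last visit to `A` within a window of length `N` occurs at a given
time are pairwise disjoint. -/
lemma measureReal_ge_of_last_visit (hT : Measurable T) (hA : MeasurableSet A)
    (hD : MeasurableSet D) (hDA : D ⊆ A) (hfin : μ A ≠ ⊤) :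
    μ.real (avoidUpTo T A N ∩ D)
      + ∑ q ∈ Finset.Ioc m N, μ.real (D ∩ T^[q] ⁻¹' (avoidUpTo T A N ∩ A)) ≤ μ.real D := by
  have hDfin : μ D ≠ ⊤ := measure_ne_top_of_subset hDA hfin
  have hF := measurableSet_avoidUpTo hT hA N
  have hmeas : ∀ q ∈ Finset.Ioc m N,
      MeasurableSet (D ∩ T^[q] ⁻¹' (avoidUpTo T A N ∩ A)) :=
    fun q _ => hD.inter ((hT.iterate q) (hF.inter hA))
  have hlt : ∀ p q, p < q → q ≤ N → ∀ x, T^[p] x ∈ avoidUpTo T A N → T^[q] x ∉ A := by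
    intro p q hpq hqN x hp hq
    refine hp (q - p) (by omega) (by omega) ?_
    rwa [← Function.iterate_add_apply, Nat.sub_add_cancel hpq.le]
  have hdisj : (Finset.Ioc m N : Set ℕ).PairwiseDisjoint
      fun q => D ∩ T^[q] ⁻¹' (avoidUpTo T A N ∩ A) := by
    intro p hp q hq hpq
    rw [Finset.mem_coe, Finset.mem_Ioc] at hp hq
    refine Set.disjoint_left.2 fun x hxp hxq => ?_
    rcases lt_or_gt_of_ne hpq with h | h
    · exact hlt p q h hq.2 x hxp.2.1 hxq.2.2
    · exact hlt q p h hp.2 x hxq.2.1 hxp.2.2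
  rw [← measureReal_biUnion_finset hdisj hmeas
      fun q _ => measure_ne_top_of_subset inter_subset_left hDfin,
    ← measureReal_union ?_ (Finset.measurableSet_biUnion _ hmeas)
      (measure_ne_top_of_subset inter_subset_right hDfin)
      (measure_ne_top_of_subset (iUnion₂_subset fun _ _ => inter_subset_left) hDfin)]
  · refine measureReal_mono ?_ hDfin
    simp only [union_subset_iff, iUnion_subset_iff, inter_subset_left, inter_subset_right,
      implies_true, and_self]
  · refine Set.disjoint_left.2 fun x hx hxq => ?_
    simp only [mem_iUnion, Finset.mem_Ioc] at hxq
    obtain ⟨q, ⟨hmq, hqN⟩, -, -, hqA⟩ := hxq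
    exact hx.1 q (by omega) hqN hqA

/-- The renewal equation for the hitting time of `A` starting from `D`, with error terms. -/
lemma abs_renewal_sub_le (hT : Measurable T) (hA : MeasurableSet A) (hD : MeasurableSet D)
    (hDA : D ⊆ A) (hfin : μ A ≠ ⊤) {β c : ℝ} (hβ : 0 ≤ β) (hc : 0 ≤ c)
    (hLLT : ∀ q : ℕ, 1 ≤ q → ∀ E : Set M, MeasurableSet E → E ⊆ A →
      |μ.real (D ∩ T^[q] ⁻¹' E) - β / q * μ.real D * μ.real E| ≤ c * (q : ℝ) ^ (-(3 : ℝ) / 2))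
    (hmN : m ≤ N) :
    |μ.real (avoidUpTo T A N ∩ D)
        + β * (∑ q ∈ Finset.Ioc m N, (q : ℝ)⁻¹) * μ.real D * μ.real (avoidUpTo T A N ∩ A)
        - μ.real D|
      ≤ μ.real ((avoidUpTo T A m)ᶜ ∩ D) + 4 * c * ((m + 1 : ℕ) : ℝ) ^ (-(1 : ℝ) / 2)
        + β * μ.real D * μ.real A := by
  have hF := measurableSet_avoidUpTo hT hA N
  have hup := measureReal_le_of_last_visit (μ := μ) (T := T) (m := m) (N := N) hDA hfin
  have hlow := measureReal_ge_of_last_visit (μ := μ) (m := m) (N := N) hT hA hD hDA hfin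
  have hsum : ∀ (a b : ℕ) (E : Set M), MeasurableSet E → E ⊆ A →
      |∑ q ∈ Finset.Ioc a b, μ.real (D ∩ T^[q] ⁻¹' E)
        - β * (∑ q ∈ Finset.Ioc a b, (q : ℝ)⁻¹) * μ.real D * μ.real E|
      ≤ c * ∑ q ∈ Finset.Ioc a b, (q : ℝ) ^ (-(3 : ℝ) / 2) := by
    intro a b E hE hEA
    rw [Finset.mul_sum, Finset.mul_sum, Finset.sum_mul, Finset.sum_mul,
      ← Finset.sum_sub_distrib]
    refine (Finset.abs_sum_le_sum_abs _ _).trans (Finset.sum_le_sum fun q hq => ?_)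
    have := hLLT q (by have := (Finset.mem_Ioc.1 hq).1; omega) E hE hEA
    rwa [div_eq_mul_inv] at this
  have h1 := abs_le.1 (hsum m N _ (hF.inter hA) inter_subset_right)
  have h2 := abs_le.1 (hsum N (2 * N) A hA subset_rfl)
  have hsplit : c * ∑ q ∈ Finset.Ioc m N, (q : ℝ) ^ (-(3 : ℝ) / 2)
      + c * ∑ q ∈ Finset.Ioc N (2 * N), (q : ℝ) ^ (-(3 : ℝ) / 2)
      ≤ 4 * c * ((m + 1 : ℕ) : ℝ) ^ (-(1 : ℝ) / 2) := by
    rw [← mul_add, Finset.sum_Ioc_consecutive _ hmN (by omega), mul_comm 4 c, mul_assoc]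
    exact mul_le_mul_of_nonneg_left (sum_Ioc_rpow_neg_three_halves_le (by omega)) hc
  have hnn : 0 ≤ c * ∑ q ∈ Finset.Ioc N (2 * N), (q : ℝ) ^ (-(3 : ℝ) / 2) :=
    mul_nonneg hc (Finset.sum_nonneg fun q _ => by positivity)
  have htail : β * (∑ q ∈ Finset.Ioc N (2 * N), (q : ℝ)⁻¹) * μ.real D * μ.real A
      ≤ β * μ.real D * μ.real A := by
    gcongr
    exact mul_le_of_le_one_right hβ (sum_Ioc_inv_two_mul_le N)
  have hm0 : 0 ≤ μ.real ((avoidUpTo T A m)ᶜ ∩ D) := measureReal_nonneg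
  have hA0 : 0 ≤ β * μ.real D * μ.real A := by positivity
  rw [abs_le]
  constructor <;> linarith [h1.1, h1.2, h2.1, h2.2]

end LastVisit

/-- Abstract form of Propositions 4.2 and 4.6 of Pène–Saussol, "Back to balls in billiards":
for a system satisfying a local limit theorem with rate `β/q`, the first hitting time `W_{A_ε}`
of small sets `A_ε`, observed on the logarithmic scale `exp(t/μ(A_ε))` and conditioned on
`D_ε ⊆ A_ε`, is asymptotically distributed as `1/(1 + βt)`, provided short returns (before
time `M_ε`) are negligible and the error terms are controlled. Here
`{W_{A_ε} > c} = {x : ∀ n ≥ 1, n ≤ c → Tⁿx ∉ A_ε}`. -/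
theorem hitting_time_log_scale_limit {M : Type*} [MeasurableSpace M] (μ : Measure M)
    (T : M → M) (hT : Measurable T) (A D : ℝ → Set M)
    (hAmeas : ∀ ε > 0, MeasurableSet (A ε)) (hDmeas : ∀ ε > 0, MeasurableSet (D ε))
    (hDA : ∀ ε > 0, D ε ⊆ A ε)
    (hD0 : ∀ ε > 0, 0 < μ (D ε)) (hA0 : ∀ ε > 0, 0 < μ (A ε))
    (hAfin : ∀ ε > 0, μ (A ε) < ⊤)
    (hAto0 : Tendsto (fun ε => (μ (A ε)).toReal) (𝓝[>] (0 : ℝ)) (𝓝 0))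
    (β c : ℝ) (hβ : 0 < β) (hc : 0 < c)
    (hLLT : ∀ ε > 0, ∀ q : ℕ, 1 ≤ q → ∀ E : Set M, MeasurableSet E → E ⊆ A ε →
      |(μ (D ε ∩ (T^[q]) ⁻¹' E)).toReal - β / q * (μ (D ε)).toReal * (μ E).toReal|
          ≤ c * (q : ℝ) ^ (-(3 : ℝ) / 2) ∧
      |(μ (A ε ∩ (T^[q]) ⁻¹' E)).toReal - β / q * (μ (A ε)).toReal * (μ E).toReal|
          ≤ c * (q : ℝ) ^ (-(3 : ℝ) / 2))
    (Mcut : ℝ → ℝ)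
    (hM1 : Tendsto Mcut (𝓝[>] (0 : ℝ)) atTop)
    (hM2 : Tendsto (fun ε => (μ (A ε)).toReal * Real.log (Mcut ε)) (𝓝[>] (0 : ℝ)) (𝓝 0))
    (hM3 : Tendsto (fun ε => (Mcut ε) ^ (-(1 : ℝ) / 2) / (μ (D ε)).toReal)
      (𝓝[>] (0 : ℝ)) (𝓝 0))
    (hM4 : Tendsto (fun ε =>
        (μ ({x | ∃ n : ℕ, 1 ≤ n ∧ (n : ℝ) ≤ Mcut ε ∧ T^[n] x ∈ A ε} ∩ D ε)).toReal
          / (μ (D ε)).toReal) (𝓝[>] (0 : ℝ)) (𝓝 0))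
    (hM5 : Tendsto (fun ε =>
        (μ ({x | ∃ n : ℕ, 1 ≤ n ∧ (n : ℝ) ≤ Mcut ε ∧ T^[n] x ∈ A ε} ∩ A ε)).toReal
          / (μ (A ε)).toReal) (𝓝[>] (0 : ℝ)) (𝓝 0)) :
    ∀ t : ℝ, 0 < t →
      Tendsto (fun ε =>
          (μ ({x | ∀ n : ℕ, 1 ≤ n → (n : ℝ) ≤ Real.exp (t / (μ (A ε)).toReal) →
                T^[n] x ∉ A ε} ∩ D ε)).toReal / (μ (D ε)).toReal)
        (𝓝[>] (0 : ℝ)) (𝓝 (1 / (1 + β * t))) := by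
  intro t ht
  have hpos : ∀ᶠ ε in 𝓝[>] (0 : ℝ), 0 < ε := self_mem_nhdsWithin
  have hfloor : ∀ (ε r : ℝ), {x | ∀ n : ℕ, 1 ≤ n → (n : ℝ) ≤ r → T^[n] x ∉ A ε}
      = avoidUpTo T (A ε) ⌊r⌋₊ := fun ε r => by
    ext x
    refine forall_congr' fun n => forall_congr' fun hn => ?_
    rw [Nat.le_floor_iff' (by omega)]
  have hfloor' : ∀ (ε r : ℝ), {x | ∃ n : ℕ, 1 ≤ n ∧ (n : ℝ) ≤ r ∧ T^[n] x ∈ A ε}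
      = (avoidUpTo T (A ε) ⌊r⌋₊)ᶜ := fun ε r => by
    rw [← hfloor]
    ext x
    simp
  simp only [hfloor', hfloor, ← measureReal_def] at *
  have hμA : ∀ ε > 0, 0 < μ.real (A ε) := fun ε hε =>
    ENNReal.toReal_pos (hA0 ε hε).ne' (hAfin ε hε).ne
  have hμD : ∀ ε > 0, 0 < μ.real (D ε) := fun ε hε =>
    ENNReal.toReal_pos (hD0 ε hε).ne' (measure_ne_top_of_subset (hDA ε hε) (hAfin ε hε).ne)
  set N : ℝ → ℕ := fun ε => ⌊Real.exp (t / μ.real (A ε))⌋₊ with hN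
  set m : ℝ → ℕ := fun ε => ⌊Mcut ε⌋₊ with hm
  set H : ℝ → ℝ := fun ε => ∑ q ∈ Finset.Ioc (m ε) (N ε), (q : ℝ)⁻¹ with hH
  set p : ℝ → ℝ := fun ε => μ.real (avoidUpTo T (A ε) (N ε) ∩ A ε) / μ.real (A ε) with hp
  have hmN : ∀ᶠ ε in 𝓝[>] (0 : ℝ), m ε ≤ N ε := by
    filter_upwards [hpos, hM1.eventually_ge_atTop 1, hM2.eventually_lt_const ht]
      with ε hε h1 h2
    refine Nat.floor_le_floor ?_
    rw [← Real.log_le_iff_le_exp (by linarith), le_div_iff₀ (hμA ε hε), mul_comm]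
    exact h2.le
  have hHlim : Tendsto (fun ε => μ.real (A ε) * H ε) (𝓝[>] (0 : ℝ)) (𝓝 t) := by
    have hl : Tendsto (fun ε => t - μ.real (A ε) - μ.real (A ε) * Real.log (Mcut ε))
        (𝓝[>] (0 : ℝ)) (𝓝 t) := by
      simpa using (hAto0.const_sub t).sub hM2
    have hu : Tendsto (fun ε => μ.real (A ε) + t) (𝓝[>] (0 : ℝ)) (𝓝 t) := by
      simpa using hAto0.add_const t
    refine tendsto_of_tendsto_of_tendsto_of_le_of_le' hl hu ?_ ?_
    · filter_upwards [hpos, hmN, hM1.eventually_ge_atTop 1] with ε hε hle h1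
      have ha := hμA ε hε
      have hlogN : t / μ.real (A ε) ≤ Real.log ((N ε + 1 : ℕ) : ℝ) := by
        rw [Real.le_log_iff_exp_le (by positivity)]
        push_cast
        exact (Nat.lt_floor_add_one _).le
      have hm1 : 0 < m ε := Nat.floor_pos.2 h1
      have hlogm : Real.log (m ε) ≤ Real.log (Mcut ε) :=
        Real.log_le_log (by exact_mod_cast hm1) (Nat.floor_le (by linarith))
      have hge : t / μ.real (A ε) - 1 - Real.log (Mcut ε) ≤ H ε := by
        simp only [hH]
        rw [sum_Ioc_inv_eq_harmonic_sub hle]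
        have := log_add_one_le_harmonic (N ε)
        have := harmonic_le_one_add_log (m ε)
        linarith
      calc t - μ.real (A ε) - μ.real (A ε) * Real.log (Mcut ε)
          = μ.real (A ε) * (t / μ.real (A ε) - 1 - Real.log (Mcut ε)) := by
            field_simp
        _ ≤ _ := by gcongr
    · filter_upwards [hpos, hmN] with ε hε hle
      have ha := hμA ε hε
      have hN1 : 0 < N ε := Nat.floor_pos.2 (Real.one_le_exp (by positivity))
      have hlogN : Real.log (N ε) ≤ t / μ.real (A ε) := by
        rw [Real.log_le_iff_le_exp (by exact_mod_cast hN1)]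
        exact Nat.floor_le (Real.exp_pos _).le
      have hle' : H ε ≤ 1 + t / μ.real (A ε) := by
        simp only [hH]
        rw [sum_Ioc_inv_eq_harmonic_sub hle]
        have := harmonic_le_one_add_log (N ε)
        have hlog := log_add_one_le_harmonic (m ε)
        have : 0 ≤ Real.log ((m ε + 1 : ℕ) : ℝ) := Real.log_natCast_nonneg _
        linarith
      calc μ.real (A ε) * H ε ≤ μ.real (A ε) * (1 + t / μ.real (A ε)) := by gcongr
        _ = _ := by field_simp
  have hrenewal : ∀ B : ℝ → Set M, (∀ ε > 0, MeasurableSet (B ε)) → (∀ ε > 0, D ε ⊆ B ε) →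
      (∀ ε > 0, B ε ⊆ A ε) →
      (∀ ε > 0, ∀ q : ℕ, 1 ≤ q → ∀ E : Set M, MeasurableSet E → E ⊆ A ε →
        |μ.real (B ε ∩ T^[q] ⁻¹' E) - β / q * μ.real (B ε) * μ.real E|
          ≤ c * (q : ℝ) ^ (-(3 : ℝ) / 2)) →
      Tendsto (fun ε => μ.real ((avoidUpTo T (A ε) (m ε))ᶜ ∩ B ε) / μ.real (B ε))
        (𝓝[>] (0 : ℝ)) (𝓝 0) →
      Tendsto (fun ε => μ.real (avoidUpTo T (A ε) (N ε) ∩ B ε) / μ.real (B ε)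
        + β * (μ.real (A ε) * H ε) * p ε) (𝓝[>] (0 : ℝ)) (𝓝 1) := by
    intro B hB hDB hBA hL hshort
    rw [tendsto_iff_norm_sub_tendsto_zero]
    have herr : Tendsto (fun ε => μ.real ((avoidUpTo T (A ε) (m ε))ᶜ ∩ B ε) / μ.real (B ε)
        + 4 * c * (Mcut ε ^ (-(1 : ℝ) / 2) / μ.real (D ε)) + β * μ.real (A ε))
        (𝓝[>] (0 : ℝ)) (𝓝 0) := by
      simpa using (hshort.add (hM3.const_mul (4 * c))).add (hAto0.const_mul β)
    refine squeeze_zero' (.of_forall fun _ => norm_nonneg _) ?_ herr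
    filter_upwards [hpos, hmN, hM1.eventually_ge_atTop 1] with ε hε hle h1
    have hmain := abs_renewal_sub_le hT (hAmeas ε hε) (hB ε hε) (hBA ε hε) (hAfin ε hε).ne
      hβ.le hc.le (hL ε hε) hle
    have ha := hμA ε hε
    have hd := hμD ε hε
    have hdb : μ.real (D ε) ≤ μ.real (B ε) :=
      measureReal_mono (hDB ε hε) (measure_ne_top_of_subset (hBA ε hε) (hAfin ε hε).ne)
    have hb : 0 < μ.real (B ε) := hd.trans_le hdb
    have hcut : ((m ε + 1 : ℕ) : ℝ) ^ (-(1 : ℝ) / 2) ≤ Mcut ε ^ (-(1 : ℝ) / 2) := by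
      refine Real.rpow_le_rpow_of_nonpos (by linarith) ?_ (by norm_num)
      push_cast
      exact (Nat.lt_floor_add_one _).le
    have heq : μ.real (avoidUpTo T (A ε) (N ε) ∩ B ε) / μ.real (B ε)
        + β * (μ.real (A ε) * H ε) * p ε - 1
        = (μ.real (avoidUpTo T (A ε) (N ε) ∩ B ε)
          + β * H ε * μ.real (B ε) * μ.real (avoidUpTo T (A ε) (N ε) ∩ A ε)
          - μ.real (B ε)) / μ.real (B ε) := by
      simp only [hp]
      field_simp
    rw [heq, Real.norm_eq_abs, abs_div, abs_of_pos hb]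
    calc _ ≤ (μ.real ((avoidUpTo T (A ε) (m ε))ᶜ ∩ B ε)
          + 4 * c * ((m ε + 1 : ℕ) : ℝ) ^ (-(1 : ℝ) / 2)
          + β * μ.real (B ε) * μ.real (A ε)) / μ.real (B ε) := by gcongr
      _ = μ.real ((avoidUpTo T (A ε) (m ε))ᶜ ∩ B ε) / μ.real (B ε)
          + 4 * c * (((m ε + 1 : ℕ) : ℝ) ^ (-(1 : ℝ) / 2) / μ.real (B ε))
          + β * μ.real (A ε) := by field_simp
      _ ≤ _ := by gcongr
  have hAr := hrenewal A hAmeas hDA (fun _ _ => subset_rfl)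
    (fun ε hε q hq E hE hEA => (hLLT ε hε q hq E hE hEA).2) hM5
  have hDr := hrenewal D hDmeas (fun _ _ => subset_rfl) hDA
    (fun ε hε q hq E hE hEA => (hLLT ε hε q hq E hE hEA).1) hM4
  have hbt : 1 + β * t ≠ 0 := by positivity
  have hfac := (hHlim.const_mul β).const_add 1
  have hplim : Tendsto p (𝓝[>] (0 : ℝ)) (𝓝 (1 / (1 + β * t))) := by
    refine (hAr.div hfac hbt).congr' ?_
    filter_upwards [hfac.eventually_ne hbt] with ε hne
    rw [Pi.div_apply, div_eq_iff hne]
    simp only [hp]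
    ring
  have hlim := hDr.sub ((hHlim.const_mul β).mul hplim)
  have hval : 1 - β * t * (1 / (1 + β * t)) = 1 / (1 + β * t) := by
    field_simp
    ring
  rw [hval] at hlim
  refine hlim.congr fun ε => ?_
  ring
end

section
/- Let μ be a Borel measure on a metric space (X, d), let F ⊆ X be a Borel set, and let m ∈ X be such that μ(Fᶜ ∩ B̄(m, r))/r² → 0 as r → 0⁺, where B̄(m,r) is the closed ball and Fᶜ the complement of F. Let c₁, c₂ > 0 and let (D_ε)_{ε>0} be Borel sets such that for every ε > 0: m ∈ D_ε, D_ε ⊆ B(m, c₂·ε), diam(D_ε) > 0 and μ(D_ε) ≥ c₁·(diam D_ε)². Then μ(Fᶜ ∩ D_ε)/μ(D_ε) → 0 as ε → 0⁺. -/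
open MeasureTheory Filter Set Topology Metric

/-- Density-point estimate underlying Lemma 3.2 of Pène–Saussol: if
`μ(Fᶜ ∩ B̄(m,r))/r² → 0` as `r → 0⁺`, then for any family of Borel sets `D_ε ∋ m` with
`D_ε ⊆ B(m, c₂ε)`, `diam D_ε > 0` and `μ(D_ε) ≥ c₁ (diam D_ε)²`, the conditional measure
of `Fᶜ` on `D_ε` tends to `0`. -/
theorem density_point_conditional_measure {X : Type*} [MetricSpace X] [MeasurableSpace X]
    [BorelSpace X] (μ : Measure X) (F : Set X) (hF : MeasurableSet F) (m : X)
    (hdens : Tendsto (fun r => μ (Fᶜ ∩ Metric.closedBall m r) / ENNReal.ofReal (r ^ 2))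
      (𝓝[>] (0 : ℝ)) (𝓝 0))
    (c₁ c₂ : ℝ) (hc₁ : 0 < c₁) (hc₂ : 0 < c₂)
    (D : ℝ → Set X) (hDmeas : ∀ ε > 0, MeasurableSet (D ε)) (hm : ∀ ε > 0, m ∈ D ε)
    (hsub : ∀ ε > 0, D ε ⊆ Metric.ball m (c₂ * ε))
    (hdiam : ∀ ε > 0, 0 < Metric.diam (D ε))
    (hlow : ∀ ε > 0, ENNReal.ofReal (c₁ * Metric.diam (D ε) ^ 2) ≤ μ (D ε)) :
    Tendsto (fun ε => μ (Fᶜ ∩ D ε) / μ (D ε)) (𝓝[>] (0 : ℝ)) (𝓝 0) := by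
  have hpos : ∀ᶠ ε : ℝ in 𝓝[>] 0, 0 < ε := self_mem_nhdsWithin
  have hbdd : ∀ ε > 0, Bornology.IsBounded (D ε) := fun ε hε =>
    isBounded_ball.subset (hsub ε hε)
  have hdiam_le : ∀ ε > 0, diam (D ε) ≤ 2 * (c₂ * ε) := fun ε hε =>
    (diam_mono (hsub ε hε) isBounded_ball).trans (diam_ball (by positivity))
  have hdiam_tendsto : Tendsto (fun ε => diam (D ε)) (𝓝[>] (0 : ℝ)) (𝓝[>] 0) := by
    refine tendsto_nhdsWithin_iff.2 ⟨?_, hpos.mono hdiam⟩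
    have hlin : Tendsto (fun ε : ℝ => 2 * (c₂ * ε)) (𝓝[>] 0) (𝓝 0) := by
      have hcont : Continuous fun ε : ℝ => 2 * (c₂ * ε) := by fun_prop
      simpa using (hcont.tendsto 0).mono_left nhdsWithin_le_nhds
    exact squeeze_zero' (Eventually.of_forall fun _ => diam_nonneg) (hpos.mono hdiam_le) hlin
  have hc₁' : ENNReal.ofReal c₁ ≠ 0 := (ENNReal.ofReal_pos.2 hc₁).ne'
  have hlim := ENNReal.Tendsto.const_mul (a := (ENNReal.ofReal c₁)⁻¹)
    (hdens.comp hdiam_tendsto) (Or.inr (ENNReal.inv_ne_top.2 hc₁'))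
  rw [mul_zero] at hlim
  refine tendsto_of_tendsto_of_tendsto_of_le_of_le' tendsto_const_nhds hlim
    (Eventually.of_forall fun _ => zero_le) (hpos.mono fun ε hε => ?_)
  have hball : D ε ⊆ closedBall m (diam (D ε)) := fun x hx =>
    dist_le_diam_of_mem (hbdd ε hε) hx (hm ε hε)
  calc μ (Fᶜ ∩ D ε) / μ (D ε)
      ≤ μ (Fᶜ ∩ closedBall m (diam (D ε))) / ENNReal.ofReal (c₁ * diam (D ε) ^ 2) :=
        ENNReal.div_le_div (measure_mono (inter_subset_inter_right _ hball)) (hlow ε hε)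
    _ = (ENNReal.ofReal c₁)⁻¹ *
        (μ (Fᶜ ∩ closedBall m (diam (D ε))) / ENNReal.ofReal (diam (D ε) ^ 2)) := by
        rw [ENNReal.ofReal_mul hc₁.le, div_eq_mul_inv, div_eq_mul_inv,
          ENNReal.mul_inv (Or.inl hc₁') (Or.inl ENNReal.ofReal_ne_top), mul_left_comm]
end

section
/- Let α ∈ (0,1), set ε_n = (log n)^{-α} for n ≥ 2 and n_k = ⌈exp(k^{2/(1−α)})⌉ for k ≥ 1. Let ε₀ > 0 and let W : (0, ε₀) → [3, +∞] be nonincreasing (ε ≤ ε′ implies W(ε) ≥ W(ε′)), with the convention log log(+∞) = +∞. If there exists K such that W(ε_{n_k}) < n_k for all k ≥ K, then limsup_{ε → 0⁺} (log log W(ε))/(−log ε) ≤ 1/α. -/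
open MeasureTheory Filter Set Topology
open scoped ENNReal

/-- The double-logarithmic ratio `log log W(ε) / (−log ε)` for an `[0,∞]`-valued
function `W`, with the convention `log log (+∞) = +∞`, as an extended real number. -/
noncomputable def loglogRatio (W : ℝ → ℝ≥0∞) (ε : ℝ) : EReal :=
  if W ε = ⊤ then ⊤
  else ((Real.log (Real.log (W ε).toReal) / (-Real.log ε) : ℝ) : EReal)

/-- Rounding `exp t` up to an integer changes its logarithm by at most a factor two. -/
lemma le_log_ceil_exp_and_le_two_mul {t : ℝ} (ht : 1 ≤ t) :
    t ≤ Real.log (⌈Real.exp t⌉₊ : ℝ) ∧ Real.log (⌈Real.exp t⌉₊ : ℝ) ≤ 2 * t := by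
  have hle : Real.exp t ≤ (⌈Real.exp t⌉₊ : ℝ) := Nat.le_ceil _
  have hpos : (0 : ℝ) < (⌈Real.exp t⌉₊ : ℝ) := (Real.exp_pos t).trans_le hle
  refine ⟨(Real.le_log_iff_exp_le hpos).2 hle, (Real.log_le_iff_le_exp hpos).2 ?_⟩
  have hlt := Nat.ceil_lt_add_one (Real.exp_pos t).le
  have htwo : 2 ≤ Real.exp t := by linarith [Real.add_one_le_exp t]
  have hsq : Real.exp (2 * t) = Real.exp t * Real.exp t := by rw [← Real.exp_add]; ring_nf
  rw [hsq]
  nlinarith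

/-- An integer bound `3 ≤ w < n` bounds `log log w` by `log log n`. -/
lemma log_log_toReal_le_of_lt_natCast {w : ℝ≥0∞} {n : ℕ} (h3 : 3 ≤ w) (hn : w < n) :
    Real.log (Real.log w.toReal) ≤ Real.log (Real.log n) := by
  have hw3 : (3 : ℝ) ≤ w.toReal := by
    simpa using ENNReal.toReal_mono hn.ne_top h3
  have hwn : w.toReal ≤ n := by
    simpa using ENNReal.toReal_mono (ENNReal.natCast_ne_top n) hn.le
  exact Real.log_le_log (Real.log_pos (by linarith)) (Real.log_le_log (by linarith) hwn)

/-- Consecutive values of `k ↦ k ^ p` are comparable: every `ε ∈ (0, 1]` has some `k` for which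
`log ⌈exp (k ^ p)⌉` lies between `ε ^ (-a)` and a constant multiple of it. -/
lemma exists_nat_log_ceil_exp_rpow_between {a p ε : ℝ} (ha : 0 ≤ a) (hp : 0 < p) (hε : 0 < ε)
    (hε1 : ε ≤ 1) :
    ∃ k : ℕ, ε ^ (-(a / p)) ≤ k ∧
      ε ^ (-a) ≤ Real.log (⌈Real.exp ((k : ℝ) ^ p)⌉₊ : ℝ) ∧
      Real.log (⌈Real.exp ((k : ℝ) ^ p)⌉₊ : ℝ) ≤ 2 * 2 ^ p * ε ^ (-a) := by
  set x : ℝ := ε ^ (-(a / p)) with hx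
  have hx1 : 1 ≤ x := Real.one_le_rpow_of_pos_of_le_one_of_nonpos hε hε1
    (neg_nonpos.2 (div_nonneg ha hp.le))
  have hxp : x ^ p = ε ^ (-a) := by
    rw [hx, ← Real.rpow_mul hε.le]
    congr 1
    field_simp
  have hxk : x ≤ ⌈x⌉₊ := Nat.le_ceil x
  have hkx : (⌈x⌉₊ : ℝ) ≤ 2 * x := by
    linarith [Nat.ceil_lt_add_one (zero_le_one.trans hx1)]
  obtain ⟨h1, h2⟩ := le_log_ceil_exp_and_le_two_mul
    (Real.one_le_rpow (hx1.trans hxk) hp.le)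
  refine ⟨⌈x⌉₊, hxk, ?_, h2.trans ?_⟩
  · rw [← hxp]
    exact (Real.rpow_le_rpow (by linarith) hxk hp.le).trans h1
  · rw [← hxp, mul_assoc, ← Real.mul_rpow zero_le_two (by linarith)]
    exact mul_le_mul_of_nonneg_left (Real.rpow_le_rpow (by linarith) hkx hp.le) zero_le_two

/-- Deterministic interpolation lemma (upper-bound part of Proposition 4.5 of
Pène–Saussol): let `α ∈ (0,1)`, `ε_n = (log n)^{-α}` and `n_k = ⌈exp(k^{2/(1−α)})⌉`.
If `W : (0, ε₀) → [3, +∞]` is nonincreasing and `W(ε_{n_k}) < n_k` for all `k ≥ K`,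
then `limsup_{ε → 0⁺} (log log W(ε))/(−log ε) ≤ 1/α`. -/
theorem limsup_loglog_ratio_le (α ε₀ : ℝ) (hα : α ∈ Set.Ioo (0 : ℝ) 1) (hε₀ : 0 < ε₀)
    (W : ℝ → ℝ≥0∞)
    (hW3 : ∀ ε ∈ Set.Ioo (0 : ℝ) ε₀, (3 : ℝ≥0∞) ≤ W ε)
    (hmono : ∀ ε ∈ Set.Ioo (0 : ℝ) ε₀, ∀ ε' ∈ Set.Ioo (0 : ℝ) ε₀, ε ≤ ε' → W ε' ≤ W ε)
    (hK : ∃ K : ℕ, ∀ k : ℕ, K ≤ k →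
      W ((Real.log (⌈Real.exp ((k : ℝ) ^ (2 / (1 - α)))⌉₊ : ℝ)) ^ (-α))
        < (⌈Real.exp ((k : ℝ) ^ (2 / (1 - α)))⌉₊ : ℝ≥0∞)) :
    Filter.limsup (loglogRatio W) (𝓝[>] (0 : ℝ)) ≤ ((1 / α : ℝ) : EReal) := by
  obtain ⟨hα0, hα1⟩ := hα
  obtain ⟨K, hK⟩ := hK
  set p : ℝ := 2 / (1 - α)
  have hp0 : 0 < p := div_pos two_pos (by linarith)
  set C : ℝ := 2 * 2 ^ p
  have hC0 : 0 < C := by positivity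
  have hlog : Tendsto (fun ε : ℝ => -Real.log ε) (𝓝[>] 0) atTop :=
    tendsto_neg_atBot_atTop.comp Real.tendsto_log_nhdsGT_zero
  have hlim : Tendsto (fun ε : ℝ => ((1 / α + Real.log C / (-Real.log ε) : ℝ) : EReal))
      (𝓝[>] 0) (𝓝 ((1 / α : ℝ) : EReal)) := by
    refine (continuous_coe_real_ereal.tendsto _).comp ?_
    simpa using (hlog.const_div_atTop (Real.log C)).const_add (1 / α)
  have hpow : Tendsto (fun ε : ℝ => ε ^ (-(1 / α / p))) (𝓝[>] 0) atTop :=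
    tendsto_rpow_neg_nhdsGT_zero (neg_lt_zero.2 (by positivity))
  rw [← hlim.limsup_eq]
  refine Filter.limsup_le_limsup ?_
  filter_upwards [self_mem_nhdsWithin, Ioo_mem_nhdsGT hε₀, Ioo_mem_nhdsGT one_pos,
    hpow.eventually_ge_atTop (K : ℝ)] with ε hpos hε hε1 hKε
  obtain ⟨k, hk, hlow, hup⟩ := exists_nat_log_ceil_exp_rpow_between (a := 1 / α)
    (by positivity) hp0 hpos hε1.2.le
  have hWk := hK k (by exact_mod_cast hKε.trans hk)
  set n : ℕ := ⌈Real.exp ((k : ℝ) ^ p)⌉₊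
  have hεpow : 0 < ε ^ (-(1 / α)) := Real.rpow_pos_of_pos hpos _
  have hL : 0 < Real.log n := hεpow.trans_le hlow
  have hscale : Real.log n ^ (-α) ≤ ε := by
    calc Real.log n ^ (-α) ≤ (ε ^ (-(1 / α))) ^ (-α) :=
          Real.rpow_le_rpow_of_nonpos hεpow hlow (by linarith)
      _ = ε := by
          rw [← Real.rpow_mul (le_of_lt hpos), neg_mul_neg, one_div_mul_cancel hα0.ne',
            Real.rpow_one]
  have hWε : W ε < n :=
    (hmono _ ⟨Real.rpow_pos_of_pos hL _, hscale.trans_lt hε.2⟩ ε hε hscale).trans_lt hWk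
  have hnegLog : 0 < -Real.log ε := neg_pos.2 (Real.log_neg hpos hε1.2)
  rw [loglogRatio, if_neg hWε.ne_top, EReal.coe_le_coe_iff, div_le_iff₀ hnegLog, add_mul,
    div_mul_cancel₀ _ hnegLog.ne']
  calc Real.log (Real.log (W ε).toReal) ≤ Real.log (Real.log n) :=
        log_log_toReal_le_of_lt_natCast (hW3 ε hε) hWε
    _ ≤ Real.log (C * ε ^ (-(1 / α))) := Real.log_le_log hL hup
    _ = 1 / α * -Real.log ε + Real.log C := by
        rw [Real.log_mul hC0.ne' hεpow.ne', Real.log_rpow hpos]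
        ring
end
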